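/- Let a, b > 0 and c = √(a² + b²). Then ∫_{−∞}^{∞} ab/(c cosh(t) + a) dt + ∫_{−∞}^{∞} ab/(c cosh(t) − a) dt = 2πa. -/

import Mathlib

open MeasureTheory Filter Topology in
/-- A real function with nonnegative derivative and finite limits at `±∞` has integrable
derivative. -/
theorem integrable_deriv_of_nonneg_of_tendsto {g g' : ℝ → ℝ} {m n : ℝ}
    (hderiv : ∀ x, HasDerivAt g (g' x) x) (hnonneg : ∀ x, 0 ≤ g' x)
    (hbot : Tendsto g atBot (𝓝 m)) (htop : Tendsto g atTop (𝓝 n)) : Integrable g' := by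
  have hright : IntegrableOn g' (Set.Ioi 0) :=
    integrableOn_Ioi_deriv_of_nonneg' (fun x _ => hderiv x) (fun x _ => hnonneg x) htop
  have hreflect : IntegrableOn (fun x => g' (-x)) (Set.Ioi 0) := by
    refine integrableOn_Ioi_deriv_of_nonneg' (g := fun x => -g (-x)) (l := -m)
      (fun x _ => ?_) (fun x _ => hnonneg (-x)) (hbot.comp tendsto_neg_atTop_atBot).neg
    exact ((hderiv (-x)).comp x (hasDerivAt_neg x)).neg.congr_deriv (by simp)
  have hleft : IntegrableOn g' (Set.Iic 0) := by
    rw [integrableOn_Iic_iff_integrableOn_Iio]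
    simpa using hreflect.comp_neg
  rw [← integrableOn_univ, ← Set.Iic_union_Ioi (a := (0 : ℝ))]
  exact hleft.union hright

open Real in
theorem abs_lt_of_sq_add_sq_eq_sq {b c d : ℝ} (hb : 0 < b) (hc : 0 < c)
    (h : d ^ 2 + b ^ 2 = c ^ 2) : |d| < c :=
  abs_lt_of_sq_lt_sq (by nlinarith [pow_pos hb 2]) hc.le

open Real in
theorem mul_cosh_add_pos {c d : ℝ} (h : |d| < c) (t : ℝ) : 0 < c * cosh t + d := by
  have hc : 0 < c := (abs_nonneg d).trans_lt h
  linarith [neg_abs_le d, le_mul_of_one_le_right hc.le (one_le_cosh t)]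

open Real in
theorem hasDerivAt_two_mul_arctan_exp {b c d : ℝ} (hb : 0 < b) (hc : 0 < c)
    (h : d ^ 2 + b ^ 2 = c ^ 2) (t : ℝ) :
    HasDerivAt (fun t => 2 * arctan ((c * exp t + d) / b)) (b / (c * cosh t + d)) t := by
  have hpos := mul_cosh_add_pos (abs_lt_of_sq_add_sq_eq_sq hb hc h) t
  have hderiv := (((((hasDerivAt_exp t).const_mul c).add_const d).div_const b).arctan).const_mul 2
  refine hderiv.congr_deriv ?_
  have hsq : b ^ 2 + (c * exp t + d) ^ 2 = 2 * c * exp t * (c * cosh t + d) := by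
    have hexp : exp t * exp (-t) = 1 := by rw [← exp_add]; simp
    rw [cosh_eq]
    linear_combination h - c ^ 2 * hexp
  have hden : 1 + ((c * exp t + d) / b) ^ 2 = 2 * c * exp t * (c * cosh t + d) / b ^ 2 := by
    rw [← hsq]
    field_simp
  rw [hden]
  field_simp

open Real MeasureTheory Filter Topology in
/-- The integral of `b / (c cosh t + d)` over the line, for `b, c > 0` and `d² + b² = c²`. -/
theorem integral_div_mul_cosh_add {b c d : ℝ} (hb : 0 < b) (hc : 0 < c)
    (h : d ^ 2 + b ^ 2 = c ^ 2) :
    ∫ t : ℝ, b / (c * cosh t + d) = π - 2 * arctan (d / b) := by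
  have hderiv := hasDerivAt_two_mul_arctan_exp hb hc h
  have hbot : Tendsto (fun t => 2 * arctan ((c * exp t + d) / b)) atBot
      (𝓝 (2 * arctan (d / b))) := by
    have := (((tendsto_exp_atBot.const_mul c).add_const d).div_const b)
    simpa using ((continuous_arctan.tendsto _).comp this).const_mul 2
  have htop : Tendsto (fun t => 2 * arctan ((c * exp t + d) / b)) atTop (𝓝 π) := by
    have hinner : Tendsto (fun t => (c * exp t + d) / b) atTop atTop :=
      (tendsto_atTop_add_const_right _ d
        (tendsto_exp_atTop.const_mul_atTop hc)).atTop_div_const hb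
    have := ((tendsto_arctan_atTop.mono_right nhdsWithin_le_nhds).comp hinner).const_mul 2
    rwa [mul_div_cancel₀ π two_ne_zero] at this
  have hnonneg (t : ℝ) : 0 ≤ b / (c * cosh t + d) :=
    (div_pos hb (mul_cosh_add_pos (abs_lt_of_sq_add_sq_eq_sq hb hc h) t)).le
  exact integral_of_hasDerivAt_of_tendsto hderiv
    (integrable_deriv_of_nonneg_of_tendsto hderiv hnonneg hbot htop) hbot htop

/-- The total lengths of the two nodary roulettes over `t ∈ (−∞, ∞)` sum to `2πa`. -/
theorem nodary_lengths_sum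
    (a b c : ℝ) (ha : 0 < a) (hb : 0 < b) (hc : c = Real.sqrt (a ^ 2 + b ^ 2)) :
    (∫ t : ℝ, a * b / (c * Real.cosh t + a)) +
      (∫ t : ℝ, a * b / (c * Real.cosh t - a)) = 2 * Real.pi * a := by
  have hcpos : 0 < c := hc ▸ Real.sqrt_pos.2 (by positivity)
  have hsq : a ^ 2 + b ^ 2 = c ^ 2 := by rw [hc, Real.sq_sqrt (by positivity)]
  simp only [mul_div_assoc, sub_eq_add_neg, MeasureTheory.integral_const_mul]
  rw [integral_div_mul_cosh_add hb hcpos hsq,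
    integral_div_mul_cosh_add hb hcpos (by rwa [neg_sq]), neg_div, Real.arctan_neg]
  ring
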